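/- arXiv:1207.5123 — 2 statements merged into one kernel-verified Lean document; each statement's English description precedes it below -/
import Mathlib

section
/- For every finite nonempty set M of real n×n matrices, every submultiplicative matrix norm ‖·‖ on real n×n matrices, and all positive integers k and p: max_{P∈P_k(M)} ρ(P)^{1/k} ≤ ρ̂(M) ≤ max_{P∈P_p(M)} ‖P‖^{1/p}, where ρ(P) is the spectral radius of P. -/
open Matrix Filter

attribute [local instance] Matrix.frobeniusNormedAddCommGroup

/-- Products of length `k` of matrices from `M`. -/
def prodsLen {n : ℕ} (M : Set (Matrix (Fin n) (Fin n) ℝ)) (k : ℕ) :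
    Set (Matrix (Fin n) (Fin n) ℝ) :=
  {P | ∃ l : List (Matrix (Fin n) (Fin n) ℝ),
      l.length = k ∧ (∀ A ∈ l, A ∈ M) ∧ P = l.prod}

/-- Joint spectral radius of a set of matrices. -/
noncomputable def jsr {n : ℕ} (M : Set (Matrix (Fin n) (Fin n) ℝ)) : ℝ :=
  limsup (fun k : ℕ => sSup ((fun P => ‖P‖ ^ ((1:ℝ)/k)) '' prodsLen M k)) atTop

/-- The spectral radius of a real matrix: the maximum modulus of its complex
eigenvalues. -/
noncomputable def specRad {n : ℕ} (P : Matrix (Fin n) (Fin n) ℝ) : ℝ :=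
  (spectralRadius ℂ (P.map (algebraMap ℝ ℂ))).toReal

section helpers

attribute [local instance] Matrix.frobeniusNormedSpace

variable {n : ℕ} {M : Set (Matrix (Fin n) (Fin n) ℝ)}

/-- A seminorm on a finite-dimensional real normed space which vanishes only at `0` dominates
the norm. -/
lemma exists_norm_le_mul_seminorm {E : Type*} [NormedAddCommGroup E] [NormedSpace ℝ E]
    [FiniteDimensional ℝ E] (S : Seminorm ℝ E) (hS : ∀ x, S x = 0 → x = 0) :
    ∃ C : ℝ, 0 < C ∧ ∀ x, ‖x‖ ≤ C * S x := by
  have hcont : Continuous S :=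
    continuousOn_univ.1 (S.convexOn.continuousOn isOpen_univ)
  have hproper : ProperSpace E := FiniteDimensional.proper ℝ E
  rcases (Metric.sphere (0 : E) 1).eq_empty_or_nonempty with hempty | hne
  · refine ⟨1, one_pos, fun x => ?_⟩
    have hx : x = 0 := by
      by_contra hx
      have : ‖x‖⁻¹ • x ∈ Metric.sphere (0 : E) 1 := by
        simp [norm_smul, norm_ne_zero_iff.2 hx]
      simp [hempty] at this
    simp [hx]
  · obtain ⟨y, hy, hmin⟩ := (isCompact_sphere (0 : E) 1).exists_isMinOn hne hcont.continuousOn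
    have hy0 : y ≠ 0 := by
      rintro rfl
      simp at hy
    have hSy : 0 < S y := lt_of_le_of_ne (apply_nonneg S y) fun h => hy0 (hS y h.symm)
    refine ⟨(S y)⁻¹, inv_pos.2 hSy, fun x => ?_⟩
    rcases eq_or_ne x 0 with rfl | hx
    · simp
    have hx' : 0 < ‖x‖ := norm_pos_iff.2 hx
    have hmem : ‖x‖⁻¹ • x ∈ Metric.sphere (0 : E) 1 := by
      simp [norm_smul, hx'.ne']
    have h : S y ≤ S (‖x‖⁻¹ • x) := hmin hmem
    rw [map_smul_eq_mul, norm_inv, norm_norm, inv_mul_eq_div, le_div_iff₀ hx'] at h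
    rw [inv_mul_eq_div, le_div_iff₀ hSy]
    linarith

lemma finite_prodsLen (hM : M.Finite) (k : ℕ) : (prodsLen M k).Finite := by
  induction k with
  | zero =>
    refine (Set.finite_singleton 1).subset ?_
    rintro P ⟨l, hl, -, rfl⟩
    simp [List.length_eq_zero_iff.1 hl]
  | succ k ih =>
    refine (hM.image2 (· * ·) ih).subset ?_
    rintro P ⟨l, hl, hlM, rfl⟩
    match l, hl, hlM with
    | A :: l, hl, hlM =>
      exact ⟨A, hlM A (by simp), l.prod,
        ⟨l, by simpa using hl, fun B hB => hlM B (by simp [hB]), rfl⟩, by simp⟩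

lemma pow_mem_prodsLen {k : ℕ} {P : Matrix (Fin n) (Fin n) ℝ} (hP : P ∈ prodsLen M k) (m : ℕ) :
    P ^ m ∈ prodsLen M (k * m) := by
  obtain ⟨l, hl, hlM, rfl⟩ := hP
  refine ⟨(List.replicate m l).flatten, ?_, ?_, ?_⟩
  · simp [hl, mul_comm]
  · intro A hA
    simp only [List.mem_flatten, List.mem_replicate] at hA
    obtain ⟨l', ⟨-, rfl⟩, hA⟩ := hA
    exact hlM A hA
  · simp [List.prod_flatten]

/-- A submultiplicative function bounded by `b ^ p` on products of length `p` grows at most like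
`b ^ k` on products of length `k`. -/
lemma exists_le_mul_pow_of_le_pow (hM : M.Finite) {N : Matrix (Fin n) (Fin n) ℝ → ℝ}
    (hN : ∀ P, 0 ≤ N P) (hNmul : ∀ P Q, N (P * Q) ≤ N P * N Q) {p : ℕ} (hp : 1 ≤ p) {b : ℝ}
    (hb : 0 < b) (h : ∀ P ∈ prodsLen M p, N P ≤ b ^ p) :
    ∃ D : ℝ, 0 < D ∧ ∀ k, ∀ P ∈ prodsLen M k, N P ≤ D * b ^ k := by
  have hex : ∀ j, ∃ d : ℝ, 0 ≤ d ∧ ∀ P ∈ prodsLen M j, N P ≤ d * b ^ j := by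
    intro j
    obtain ⟨u, hu⟩ := ((finite_prodsLen hM j).image N).bddAbove
    have hbj : 0 < b ^ j := pow_pos hb j
    refine ⟨|u| / b ^ j, by positivity, fun P hP => ?_⟩
    rw [div_mul_cancel₀ _ hbj.ne']
    exact (hu ⟨P, hP, rfl⟩).trans (le_abs_self u)
  choose d hd0 hd using hex
  have hsum : 0 ≤ ∑ j ∈ Finset.range p, d j := Finset.sum_nonneg fun j _ => hd0 j
  refine ⟨1 + ∑ j ∈ Finset.range p, d j, by linarith, fun k => ?_⟩
  induction k using Nat.strong_induction_on with
  | _ k ih =>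
    intro P hP
    rcases lt_or_ge k p with hk | hk
    · refine (hd k P hP).trans (mul_le_mul_of_nonneg_right ?_ (pow_pos hb k).le)
      have := Finset.single_le_sum (fun j _ => hd0 j) (Finset.mem_range.2 hk)
      linarith
    · obtain ⟨l, hl, hlM, rfl⟩ := hP
      have h₁ : N (l.take p).prod ≤ b ^ p :=
        h _ ⟨l.take p, by simp [hl, hk], fun A hA => hlM A (List.mem_of_mem_take hA), rfl⟩
      have h₂ := ih (k - p) (by omega) (l.drop p).prod
        ⟨l.drop p, by simp [hl], fun A hA => hlM A (List.mem_of_mem_drop hA), rfl⟩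
      calc N l.prod = N ((l.take p).prod * (l.drop p).prod) := by rw [List.prod_take_mul_prod_drop]
        _ ≤ N (l.take p).prod * N (l.drop p).prod := hNmul _ _
        _ ≤ b ^ p * ((1 + ∑ j ∈ Finset.range p, d j) * b ^ (k - p)) :=
          mul_le_mul h₁ h₂ (hN _) (pow_pos hb p).le
        _ = (1 + ∑ j ∈ Finset.range p, d j) * (b ^ p * b ^ (k - p)) := by ring
        _ = (1 + ∑ j ∈ Finset.range p, d j) * b ^ k := by rw [← pow_add, Nat.add_sub_cancel' hk]

lemma tendsto_rpow_one_div {D : ℝ} (hD : 0 < D) :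
    Tendsto (fun k : ℕ => D ^ ((1 : ℝ) / k)) atTop (nhds 1) := by
  have h := (Real.continuousAt_const_rpow (b := 0) hD.ne').tendsto.comp
    tendsto_one_div_atTop_nhds_zero_nat
  simpa [Function.comp_def] using h

lemma sSup_rpow_norm_nonneg (k : ℕ) :
    0 ≤ sSup ((fun P => ‖P‖ ^ ((1 : ℝ) / k)) '' prodsLen M k) := by
  refine Real.sSup_nonneg ?_
  rintro _ ⟨P, -, rfl⟩
  positivity

lemma sSup_rpow_norm_eventuallyLE {D b : ℝ} (hD : 0 < D) (hb : 0 < b)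
    (h : ∀ k, ∀ P ∈ prodsLen M k, ‖P‖ ≤ D * b ^ k) :
    (fun k : ℕ => sSup ((fun P => ‖P‖ ^ ((1 : ℝ) / k)) '' prodsLen M k)) ≤ᶠ[atTop]
      fun k : ℕ => D ^ ((1 : ℝ) / k) * b := by
  filter_upwards [eventually_ge_atTop 1] with k hk
  refine Real.sSup_le ?_ (by positivity)
  rintro _ ⟨P, hP, rfl⟩
  calc ‖P‖ ^ ((1 : ℝ) / k) ≤ (D * b ^ k) ^ ((1 : ℝ) / k) :=
        Real.rpow_le_rpow (norm_nonneg P) (h k P hP) (by positivity)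
    _ = D ^ ((1 : ℝ) / k) * b := by
        rw [Real.mul_rpow hD.le (by positivity), one_div,
          Real.pow_rpow_inv_natCast hb.le (by omega)]

lemma tendsto_rpow_one_div_mul {D : ℝ} (hD : 0 < D) (b : ℝ) :
    Tendsto (fun k : ℕ => D ^ ((1 : ℝ) / k) * b) atTop (nhds b) := by
  simpa using (tendsto_rpow_one_div hD).mul_const b

lemma jsr_le_of_norm_le {D b : ℝ} (hD : 0 < D) (hb : 0 < b)
    (h : ∀ k, ∀ P ∈ prodsLen M k, ‖P‖ ≤ D * b ^ k) : jsr M ≤ b := by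
  have ht := tendsto_rpow_one_div_mul hD b
  rw [← ht.limsup_eq]
  exact limsup_le_limsup (sSup_rpow_norm_eventuallyLE hD hb h)
    (isCoboundedUnder_le_of_le atTop sSup_rpow_norm_nonneg) ht.isBoundedUnder_le

lemma isBoundedUnder_sSup_rpow_norm (hM : M.Finite) :
    IsBoundedUnder (· ≤ ·) atTop
      (fun k : ℕ => sSup ((fun P => ‖P‖ ^ ((1 : ℝ) / k)) '' prodsLen M k)) := by
  obtain ⟨u, hu⟩ := ((finite_prodsLen hM 1).image fun P => ‖P‖).bddAbove
  have hb : 0 < |u| + 1 := by positivity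
  obtain ⟨D, hD, h⟩ := exists_le_mul_pow_of_le_pow hM (fun P => norm_nonneg P)
    Matrix.frobenius_norm_mul le_rfl hb fun P hP => by
      have h₁ : ‖P‖ ≤ u := hu ⟨P, hP, rfl⟩
      have h₂ := le_abs_self u
      rw [pow_one]
      linarith
  exact (tendsto_rpow_one_div_mul hD _).isBoundedUnder_le.mono_le
    (sSup_rpow_norm_eventuallyLE hD hb h)

lemma rpow_one_div_le_jsr (hM : M.Finite) {k : ℕ} (hk : 1 ≤ k) {P : Matrix (Fin n) (Fin n) ℝ}
    (hP : P ∈ prodsLen M k) {r c : ℝ} (hr : 0 ≤ r) (hc : 0 < c)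
    (h : ∀ m, 1 ≤ m → r ^ m ≤ c * ‖P ^ m‖) : r ^ ((1 : ℝ) / k) ≤ jsr M := by
  have hmul : Tendsto (fun m : ℕ => k * m) atTop atTop :=
    tendsto_id.const_mul_atTop' hk
  have ht : Tendsto (fun m : ℕ => r ^ ((1 : ℝ) / k) / c ^ ((1 : ℝ) / (k * m : ℕ))) atTop
      (nhds (r ^ ((1 : ℝ) / k))) := by
    simpa [Function.comp_def, Pi.div_def] using (tendsto_const_nhds (x := r ^ ((1 : ℝ) / k))).div
      ((tendsto_rpow_one_div hc).comp hmul) one_ne_zero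
  refine le_of_forall_lt fun x hx => ?_
  obtain ⟨y, hxy, hy⟩ := exists_between hx
  refine hxy.trans_le (le_limsup_of_frequently_le ?_ (isBoundedUnder_sSup_rpow_norm hM))
  refine hmul.frequently (Eventually.frequently ?_)
  filter_upwards [ht.eventually_const_lt hy, eventually_ge_atTop 1] with m hm hm1
  have hkm : 0 < k * m := by positivity
  refine hm.le.trans (le_trans ?_
    (le_csSup ((finite_prodsLen hM (k * m)).image _).bddAbove
      ⟨P ^ m, pow_mem_prodsLen hP m, rfl⟩))
  rw [div_le_iff₀ (by positivity), mul_comm]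
  calc r ^ ((1 : ℝ) / k) = (r ^ m) ^ ((1 : ℝ) / (k * m : ℕ)) := by
        rw [← Real.rpow_natCast, ← Real.rpow_mul hr]
        congr 1
        push_cast
        field_simp
    _ ≤ (c * ‖P ^ m‖) ^ ((1 : ℝ) / (k * m : ℕ)) :=
        Real.rpow_le_rpow (by positivity) (h m hm1) (by positivity)
    _ = _ := Real.mul_rpow hc.le (norm_nonneg _)

lemma specRad_nonneg (P : Matrix (Fin n) (Fin n) ℝ) : 0 ≤ specRad P :=
  ENNReal.toReal_nonneg

attribute [local instance] Matrix.frobeniusNormedRing Matrix.frobeniusNormedAlgebra in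
lemma exists_specRad_pow_le (P : Matrix (Fin n) (Fin n) ℝ) :
    ∃ c : ℝ, 0 < c ∧ ∀ m, 1 ≤ m → specRad P ^ m ≤ c * ‖P ^ m‖ := by
  have hcomplete : CompleteSpace (Matrix (Fin n) (Fin n) ℂ) := FiniteDimensional.complete ℂ _
  refine ⟨‖(1 : Matrix (Fin n) (Fin n) ℂ)‖ + 1, by positivity, fun m hm => ?_⟩
  rcases subsingleton_or_nontrivial (Matrix (Fin n) (Fin n) ℂ) with hsub | hnon
  · have h0 : specRad P = 0 := by
      simp [specRad, spectralRadius]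
    rw [h0, zero_pow (by omega)]
    positivity
  · obtain ⟨z, hz, hzr⟩ := spectrum.exists_nnnorm_eq_spectralRadius (P.map (algebraMap ℝ ℂ))
    have hspec : specRad P = ‖z‖ := by
      rw [specRad, ← hzr]
      simp
    have hmap : P.map (algebraMap ℝ ℂ) ^ m = (P ^ m).map (algebraMap ℝ ℂ) :=
      (map_pow (algebraMap ℝ ℂ).mapMatrix P m).symm
    have hmem := spectrum.norm_le_norm_mul_of_mem (spectrum.pow_mem_pow _ m hz)
    rw [hmap, norm_pow, Matrix.frobenius_norm_map_eq (P ^ m) (algebraMap ℝ ℂ) (by simp)] at hmem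
    rw [hspec]
    nlinarith [norm_nonneg (P ^ m)]

end helpers

/-- for every finite nonempty set of matrices, every
submultiplicative matrix norm `N`, and all `k, p ≥ 1`, one has
`max_{P ∈ P_k} ρ(P)^(1/k) ≤ ρ̂(M) ≤ max_{P ∈ P_p} N(P)^(1/p)`. -/
theorem stmt10 {n : ℕ} (M : Set (Matrix (Fin n) (Fin n) ℝ))
    (hMfin : M.Finite) (hMne : M.Nonempty)
    (N : Matrix (Fin n) (Fin n) ℝ → ℝ)
    (hN0 : ∀ P, N P = 0 ↔ P = 0)
    (hNsmul : ∀ (c : ℝ) P, N (c • P) = |c| * N P)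
    (hNadd : ∀ P Q, N (P + Q) ≤ N P + N Q)
    (hNmul : ∀ P Q, N (P * Q) ≤ N P * N Q)
    (k p : ℕ) (hk : 1 ≤ k) (hp : 1 ≤ p) :
    sSup ((fun P => specRad P ^ ((1:ℝ)/k)) '' prodsLen M k) ≤ jsr M ∧
      jsr M ≤ sSup ((fun P => N P ^ ((1:ℝ)/p)) '' prodsLen M p) := by
  refine ⟨Real.sSup_le ?_ ?_, ?_⟩
  · rintro _ ⟨P, hP, rfl⟩
    obtain ⟨c, hc, h⟩ := exists_specRad_pow_le P
    exact rpow_one_div_le_jsr hMfin hk hP (specRad_nonneg P) hc h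
  · exact le_limsup_of_frequently_le
      (Frequently.of_forall fun k => sSup_rpow_norm_nonneg k)
      (isBoundedUnder_sSup_rpow_norm hMfin)
  · let _ : NormedSpace ℝ (Matrix (Fin n) (Fin n) ℝ) := Matrix.frobeniusNormedSpace
    let S : Seminorm ℝ (Matrix (Fin n) (Fin n) ℝ) := Seminorm.of N hNadd hNsmul
    have hN : ∀ P, 0 ≤ N P := fun P => apply_nonneg S P
    obtain ⟨C, hC, hCN⟩ := exists_norm_le_mul_seminorm S fun P => (hN0 P).1
    have hB : 0 ≤ sSup ((fun P => N P ^ ((1:ℝ)/p)) '' prodsLen M p) := by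
      refine Real.sSup_nonneg ?_
      rintro _ ⟨P, -, rfl⟩
      exact Real.rpow_nonneg (hN P) _
    refine le_of_forall_gt_imp_ge_of_dense fun b hb => ?_
    have hb0 := hB.trans_lt hb
    obtain ⟨D, hD, hDN⟩ := exists_le_mul_pow_of_le_pow hMfin hN hNmul hp hb0 fun P hP => by
      have hle : N P ^ ((1:ℝ)/p) ≤ b :=
        (le_csSup ((finite_prodsLen hMfin p).image _).bddAbove ⟨P, hP, rfl⟩).trans hb.le
      have := pow_le_pow_left₀ (Real.rpow_nonneg (hN P) _) hle p
      rwa [one_div, Real.rpow_inv_natCast_pow (hN P) (by omega)] at this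
    refine jsr_le_of_norm_le (mul_pos hC hD) hb0 fun k P hP => (hCN P).trans ?_
    rw [mul_assoc]
    exact mul_le_mul_of_nonneg_left (hDN k P hP) hC.le
end

section
/- Let M be a finite nonempty set of real n×n matrices that is irreducible (no nontrivial proper linear subspace of ℝ^n is invariant under every matrix of M) and has joint spectral radius ρ = ρ̂(M) > 0. Then the product semigroup of the normalized set M/ρ is bounded: there exists a constant C such that ‖P‖ ≤ C·ρ^k for every k ≥ 1 and every product P ∈ P_k(M). -/
open Matrix Filter

attribute [local instance] Matrix.frobeniusNormedAddCommGroup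

section JointSpectralRadius

variable {n : ℕ} {M : Set (Matrix (Fin n) (Fin n) ℝ)}

lemma one_mem_prodsLen_zero : (1 : Matrix (Fin n) (Fin n) ℝ) ∈ prodsLen M 0 :=
  ⟨[], rfl, by simp, by simp⟩

lemma eq_one_of_mem_prodsLen_zero {P : Matrix (Fin n) (Fin n) ℝ} (hP : P ∈ prodsLen M 0) :
    P = 1 := by
  obtain ⟨l, hl, -, rfl⟩ := hP
  simp [List.length_eq_zero_iff.mp hl]

lemma mem_prodsLen_one {A : Matrix (Fin n) (Fin n) ℝ} (hA : A ∈ M) : A ∈ prodsLen M 1 :=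
  ⟨[A], rfl, by simpa using hA, by simp⟩

lemma mul_mem_prodsLen {j k : ℕ} {P Q : Matrix (Fin n) (Fin n) ℝ} (hP : P ∈ prodsLen M j)
    (hQ : Q ∈ prodsLen M k) : P * Q ∈ prodsLen M (j + k) := by
  obtain ⟨l, rfl, hl, rfl⟩ := hP
  obtain ⟨l', rfl, hl', rfl⟩ := hQ
  refine ⟨l ++ l', by simp, fun A hA => ?_, by simp⟩
  rcases List.mem_append.mp hA with h | h
  exacts [hl A h, hl' A h]

lemma norm_le_pow_of_mem_prodsLen {B : ℝ} (hB : ∀ A ∈ M, ‖A‖ ≤ B) (k : ℕ) :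
    ∀ P ∈ prodsLen M (k + 1), ‖P‖ ≤ B ^ (k + 1) := by
  induction k with
  | zero =>
    rintro P ⟨l, hl, hlM, rfl⟩
    obtain ⟨A, rfl⟩ := List.length_eq_one_iff.mp hl
    simpa using hB A (hlM A (by simp))
  | succ k ih =>
    rintro P ⟨l, hl, hlM, rfl⟩
    obtain ⟨A, l, rfl⟩ := List.exists_cons_of_length_eq_add_one hl
    rw [List.prod_cons, pow_succ' B]
    have hA := hB A (hlM A (by simp))
    exact (frobenius_norm_mul _ _).trans (mul_le_mul hA
      (ih _ ⟨l, by simpa using hl, fun A hA => hlM A (by simp [hA]), rfl⟩) (norm_nonneg _)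
      ((norm_nonneg _).trans hA))

/-- The Frobenius norm is compatible with the Euclidean norm. -/
lemma norm_toLp_mulVec_le (A : Matrix (Fin n) (Fin n) ℝ) (x : Fin n → ℝ) :
    ‖WithLp.toLp 2 (A *ᵥ x)‖ ≤ ‖A‖ * ‖WithLp.toLp 2 x‖ := by
  rw [← frobenius_norm_replicateCol (ι := Unit), ← frobenius_norm_replicateCol (ι := Unit),
    replicateCol_mulVec]
  exact frobenius_norm_mul _ _

lemma norm_le_sum_norm_col (A : Matrix (Fin n) (Fin n) ℝ) :
    ‖A‖ ≤ ∑ j, ‖WithLp.toLp 2 (A *ᵥ Pi.single j 1)‖ := by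
  rw [← frobenius_norm_transpose]
  rw [frobenius_norm_def, ← Real.sqrt_eq_rpow]
  refine Real.sqrt_le_iff.mpr ⟨by positivity, ?_⟩
  refine le_trans (le_of_eq ?_) (Finset.sum_sq_le_sq_sum_of_nonneg fun j _ => norm_nonneg _)
  refine Finset.sum_congr rfl fun j _ => ?_
  simp [EuclideanSpace.norm_sq_eq]

/-- The vectors whose orbit under products of length `k` grows at most like `ρ ^ k`. -/
def boundedOrbit (M : Set (Matrix (Fin n) (Fin n) ℝ)) (ρ : ℝ) :
    Submodule ℝ (Fin n → ℝ) where
  carrier := {x | ∃ C : ℝ, ∀ k, ∀ P ∈ prodsLen M k, ‖WithLp.toLp 2 (P *ᵥ x)‖ ≤ C * ρ ^ k}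
  zero_mem' := ⟨0, by simp⟩
  add_mem' := by
    rintro x y ⟨C, hC⟩ ⟨D, hD⟩
    refine ⟨C + D, fun k P hP => ?_⟩
    rw [mulVec_add, WithLp.toLp_add, add_mul]
    exact (norm_add_le _ _).trans (add_le_add (hC k P hP) (hD k P hP))
  smul_mem' := by
    rintro c x ⟨C, hC⟩
    refine ⟨‖c‖ * C, fun k P hP => ?_⟩
    rw [mulVec_smul, WithLp.toLp_smul, norm_smul, mul_assoc]
    exact mul_le_mul_of_nonneg_left (hC k P hP) (norm_nonneg _)

lemma mulVec_mem_boundedOrbit {ρ : ℝ} {A : Matrix (Fin n) (Fin n) ℝ} (hA : A ∈ M)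
    {x : Fin n → ℝ} (hx : x ∈ boundedOrbit M ρ) : A *ᵥ x ∈ boundedOrbit M ρ := by
  obtain ⟨C, hC⟩ := hx
  refine ⟨C * ρ, fun k P hP => ?_⟩
  rw [mulVec_mulVec, mul_assoc, ← pow_succ']
  exact hC (k + 1) _ (mul_mem_prodsLen hP (mem_prodsLen_one hA))

lemma exists_norm_le_of_boundedOrbit_eq_top {ρ : ℝ}
    (h : boundedOrbit M ρ = ⊤) : ∃ C : ℝ, ∀ k, ∀ P ∈ prodsLen M k, ‖P‖ ≤ C * ρ ^ k := by
  have hmem (j : Fin n) : (Pi.single j 1 : Fin n → ℝ) ∈ boundedOrbit M ρ := h ▸ trivial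
  choose C hC using hmem
  refine ⟨∑ j, C j, fun k P hP => (norm_le_sum_norm_col P).trans ?_⟩
  rw [Finset.sum_mul]
  exact Finset.sum_le_sum fun j _ => hC j k P hP

/-- If every nonzero orbit is unbounded relative to `ρ ^ k`, some product of uniformly bounded
length expands any given vector at an exponential rate exceeding `ρ`. -/
lemma exists_rate_of_boundedOrbit_eq_bot {ρ : ℝ} (hρ : 0 < ρ) (h : boundedOrbit M ρ = ⊥) :
    ∃ r > ρ, ∀ x : Fin n → ℝ, x ≠ 0 → ∃ k, 1 ≤ k ∧ ∃ P ∈ prodsLen M k,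
      r ^ k * ‖WithLp.toLp 2 x‖ ≤ ‖WithLp.toLp 2 (P *ᵥ x)‖ ∧ P *ᵥ x ≠ 0 := by
  let U : (Σ k, prodsLen M k) → Set (EuclideanSpace ℝ (Fin n)) := fun i =>
    {x | 2 * ρ ^ i.1 < ‖WithLp.toLp 2 (i.2.1 *ᵥ x.ofLp)‖}
  have hU (i) : IsOpen (U i) := by
    refine isOpen_lt continuous_const (Continuous.norm ?_)
    exact (PiLp.continuous_toLp 2 _).comp
      (Continuous.matrix_mulVec continuous_const (PiLp.continuous_ofLp 2 _))
  have hcover : Metric.sphere (0 : EuclideanSpace ℝ (Fin n)) 1 ⊆ ⋃ i, U i := by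
    intro x hx
    by_contra hxU
    have hxW : x.ofLp ∈ boundedOrbit M ρ :=
      ⟨2, fun k P hP => not_lt.mp fun hlt => hxU (Set.mem_iUnion.mpr ⟨⟨k, P, hP⟩, hlt⟩)⟩
    rw [h, Submodule.mem_bot] at hxW
    have hx0 : x = 0 := by ext i; simp [hxW]
    simp [hx0] at hx
  obtain ⟨t, ht⟩ := (isCompact_sphere _ _).elim_finite_subcover U hU hcover
  obtain ⟨N, hN⟩ : ∃ N : ℕ, ∀ i ∈ t, i.1 ≤ N :=
    ⟨t.sup Sigma.fst, fun i hi => Finset.le_sup (f := Sigma.fst) hi⟩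
  set q : ℝ := 2 ^ ((1 : ℝ) / (N + 1 : ℕ)) with hq
  have hq1 : 1 < q := Real.one_lt_rpow (by norm_num) (by positivity)
  have hq2 : q ^ (N + 1) = 2 := by
    rw [hq, one_div]
    exact Real.rpow_inv_natCast_pow (by norm_num) (by omega)
  refine ⟨q * ρ, by nlinarith, fun x hx => ?_⟩
  have hnx : 0 < ‖WithLp.toLp 2 x‖ := by
    rw [norm_pos_iff]
    simpa using hx
  have hy : WithLp.toLp 2 (‖WithLp.toLp 2 x‖⁻¹ • x) ∈
      Metric.sphere (0 : EuclideanSpace ℝ (Fin n)) 1 := by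
    rw [mem_sphere_zero_iff_norm, WithLp.toLp_smul, norm_smul, norm_inv, norm_norm,
      inv_mul_cancel₀ hnx.ne']
  obtain ⟨⟨k, P, hP⟩, hit, hi⟩ := Set.mem_iUnion₂.mp (ht hy)
  have hgrow : 2 * ρ ^ k * ‖WithLp.toLp 2 x‖ < ‖WithLp.toLp 2 (P *ᵥ x)‖ := by
    change 2 * ρ ^ k < ‖WithLp.toLp 2 (P *ᵥ (‖WithLp.toLp 2 x‖⁻¹ • x))‖ at hi
    rw [mulVec_smul, WithLp.toLp_smul, norm_smul, norm_inv, norm_norm] at hi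
    rwa [lt_inv_mul_iff₀ hnx, mul_comm] at hi
  refine ⟨k, ?_, P, hP, ?_, ?_⟩
  · rcases Nat.eq_zero_or_pos k with rfl | hk
    · rw [eq_one_of_mem_prodsLen_zero hP, one_mulVec] at hgrow
      linarith
    · exact hk
  · refine le_trans ?_ hgrow.le
    rw [mul_pow]
    have : q ^ k ≤ 2 := hq2 ▸ pow_le_pow_right₀ hq1.le ((hN _ hit).trans N.le_succ)
    gcongr
  · intro h0
    rw [h0, WithLp.toLp_zero, norm_zero] at hgrow
    exact absurd hgrow (not_lt.mpr (by positivity))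

lemma exists_pow_le_norm_of_boundedOrbit_eq_bot {ρ : ℝ} (hρ : 0 < ρ)
    (h : boundedOrbit M ρ = ⊥) {x : Fin n → ℝ} (hx : x ≠ 0) :
    ∃ r > ρ, ∀ m : ℕ, ∃ k ≥ m, ∃ P ∈ prodsLen M k, r ^ k ≤ ‖P‖ := by
  obtain ⟨r, hr, hstep⟩ := exists_rate_of_boundedOrbit_eq_bot hρ h
  have hr0 : 0 < r := hρ.trans hr
  have hiter (m : ℕ) : ∃ k ≥ m, ∃ P ∈ prodsLen M k,
      r ^ k * ‖WithLp.toLp 2 x‖ ≤ ‖WithLp.toLp 2 (P *ᵥ x)‖ ∧ P *ᵥ x ≠ 0 := by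
    induction m with
    | zero => exact ⟨0, le_rfl, 1, one_mem_prodsLen_zero, by simp, by simpa using hx⟩
    | succ m ih =>
      obtain ⟨k, hk, P, hP, hle, hne⟩ := ih
      obtain ⟨j, hj, Q, hQ, hle', hne'⟩ := hstep _ hne
      rw [mulVec_mulVec] at hle' hne'
      refine ⟨j + k, by omega, Q * P, mul_mem_prodsLen hQ hP, le_trans ?_ hle', hne'⟩
      rw [pow_add, mul_assoc]
      gcongr
  refine ⟨r, hr, fun m => ?_⟩
  obtain ⟨k, hk, P, hP, hle, -⟩ := hiter m
  have hnx : 0 < ‖WithLp.toLp 2 x‖ := by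
    rw [norm_pos_iff]
    simpa using hx
  exact ⟨k, hk, P, hP, le_of_mul_le_mul_right (hle.trans (norm_toLp_mulVec_le P x)) hnx⟩

lemma eventually_norm_lt_pow_of_jsr_lt (hM : M.Finite) {r : ℝ} (hr : jsr M < r) :
    ∀ᶠ k in atTop, ∀ P ∈ prodsLen M k, ‖P‖ < r ^ k := by
  obtain ⟨B, hB⟩ := (hM.image norm).bddAbove
  have hB' : ∀ A ∈ M, ‖A‖ ≤ max B 0 := fun A hA =>
    (hB (Set.mem_image_of_mem _ hA)).trans (le_max_left _ _)
  have hroot (k : ℕ) (hk : 1 ≤ k) : ∀ y ∈ (fun P => ‖P‖ ^ ((1 : ℝ) / k)) '' prodsLen M k,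
      y ≤ max B 0 := by
    rintro _ ⟨P, hP, rfl⟩
    obtain ⟨k, rfl⟩ := Nat.exists_eq_add_of_le' hk
    have := norm_le_pow_of_mem_prodsLen hB' k P hP
    dsimp only
    rw [one_div]
    exact (Real.rpow_inv_le_iff_of_pos (norm_nonneg _) (le_max_right _ _) (by positivity)).mpr
      (by exact_mod_cast this)
  have hbdd : IsBoundedUnder (· ≤ ·) atTop
      fun k : ℕ => sSup ((fun P => ‖P‖ ^ ((1 : ℝ) / k)) '' prodsLen M k) :=
    isBoundedUnder_of_eventually_le (a := max B 0) <| (eventually_ge_atTop 1).mono fun k hk =>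
      Real.sSup_le (hroot k hk) (le_max_right _ _)
  filter_upwards [eventually_lt_of_limsup_lt hr hbdd, eventually_ge_atTop 1] with k hk hk1 P hP
  have hlt : ‖P‖ ^ ((1 : ℝ) / k) < r :=
    (le_csSup ⟨_, hroot k hk1⟩ (Set.mem_image_of_mem _ hP)).trans_lt hk
  calc ‖P‖ = (‖P‖ ^ ((1 : ℝ) / k)) ^ k := by
        rw [one_div, Real.rpow_inv_natCast_pow (norm_nonneg _) (by omega)]
    _ < r ^ k := pow_lt_pow_left₀ hlt (by positivity) (by omega)

end JointSpectralRadius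

/-- if a finite nonempty set `M` of matrices is irreducible and
`ρ = ρ̂(M) > 0`, then the semigroup of products of the normalized family `M/ρ`
is bounded: `‖P‖ ≤ C · ρ^k` for every product `P` of length `k ≥ 1`. -/
theorem stmt14 {n : ℕ} (M : Set (Matrix (Fin n) (Fin n) ℝ))
    (hMfin : M.Finite) (hMne : M.Nonempty)
    (hirr : ∀ W : Submodule ℝ (Fin n → ℝ),
      (∀ A ∈ M, ∀ x ∈ W, A.mulVec x ∈ W) → W = ⊥ ∨ W = ⊤)
    (hpos : 0 < jsr M) :
    ∃ C : ℝ, ∀ k : ℕ, 1 ≤ k → ∀ P ∈ prodsLen M k, ‖P‖ ≤ C * jsr M ^ k := by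
  by_cases htop : boundedOrbit M (jsr M) = ⊤
  · obtain ⟨C, hC⟩ := exists_norm_le_of_boundedOrbit_eq_top htop
    exact ⟨C, fun k _ => hC k⟩
  have hbot := (hirr _ fun A hA x hx => mulVec_mem_boundedOrbit hA hx).resolve_right htop
  obtain ⟨x, -, hx⟩ := SetLike.exists_of_lt (hbot ▸ lt_top_iff_ne_top.mpr htop)
  obtain ⟨r, hr, hgrow⟩ := exists_pow_le_norm_of_boundedOrbit_eq_bot hpos hbot
    (x := x) (by simpa using hx)
  obtain ⟨m, hm⟩ := eventually_atTop.mp (eventually_norm_lt_pow_of_jsr_lt hMfin hr)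
  obtain ⟨k, hk, P, hP, hle⟩ := hgrow m
  exact absurd (hm k hk P hP) (not_lt.mpr hle)
end
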